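/- Constructive tropical Pappus: For any five points 1,2,3,4,5 in the tropical projective plane, define lines a = 1⊗4, b = 2⊗4, c = 3⊗4, a' = 1⊗5, b' = 2⊗5, c' = 3⊗5, points 6 = b⊗c', 7 = a'⊗c, 8 = a⊗b', and lines a'' = 1⊗6, b'' = 2⊗7, c'' = 3⊗8, where ⊗ is the tropical cross product. Then the three tropical lines determined by a'', b'', c'' have a common point: there exists z in the tropical projective plane lying on all three tropical lines. -/

import Mathlib

/-- The tropical cross product of two points of the tropical projective plane. -/
noncomputable def tcross (x y : Fin 3 → ℝ) : Fin 3 → ℝ :=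
  ![max (x 1 + y 2) (x 2 + y 1), max (x 0 + y 2) (x 2 + y 0),
    max (x 0 + y 1) (x 1 + y 0)]

/-- A point `z` lies on the tropical line with coefficient vector `w` iff the maximum
of `w j + z j` is attained at least twice. -/
def OnTropLine (w z : Fin 3 → ℝ) : Prop :=
  ∃ j j' : Fin 3, j ≠ j' ∧ w j + z j = w j' + z j' ∧ ∀ m, w m + z m ≤ w j + z j

theorem eq_and_le_cases_of_le_max {α : Type*} [LinearOrder α] {a b c : α} (ha : a ≤ max b c)
    (hb : b ≤ max c a) (hc : c ≤ max a b) :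
    (b = c ∧ a ≤ c) ∨ (a = c ∧ b ≤ c) ∨ (a = b ∧ c ≤ b) := by
  grind

theorem onTropLine_of_le_max {w z : Fin 3 → ℝ}
    (h0 : w 0 + z 0 ≤ max (w 1 + z 1) (w 2 + z 2))
    (h1 : w 1 + z 1 ≤ max (w 0 + z 0) (w 2 + z 2))
    (h2 : w 2 + z 2 ≤ max (w 0 + z 0) (w 1 + z 1)) : OnTropLine w z := by
  rcases eq_and_le_cases_of_le_max h0 (max_comm (w 0 + z 0) _ ▸ h1) h2 with
    ⟨h, h'⟩ | ⟨h, h'⟩ | ⟨h, h'⟩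
  · exact ⟨2, 1, by decide, h.symm,
      Fin.forall_fin_succ.2 ⟨h', Fin.forall_fin_two.2 ⟨h.le, le_rfl⟩⟩⟩
  · exact ⟨2, 0, by decide, h.symm,
      Fin.forall_fin_succ.2 ⟨h.le, Fin.forall_fin_two.2 ⟨h', le_rfl⟩⟩⟩
  · exact ⟨1, 0, by decide, h.symm,
      Fin.forall_fin_succ.2 ⟨h.le, Fin.forall_fin_two.2 ⟨le_rfl, h'⟩⟩⟩

set_option maxHeartbeats 1000000 in
-- Each side expands into a maximum of 16 sums, for each of the three coordinates.
/-- Each coordinate of the first line of the Pappus configuration is at most the maximum of the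
corresponding coordinates of the other two: classically the three lines, suitably scaled, sum to
zero, and every monomial of one of them occurs in another. -/
theorem tcross_pappus_le_max (p q r s t : Fin 3 → ℝ) (j : Fin 3) :
    tcross p (tcross (tcross q s) (tcross r t)) j ≤
      max (tcross q (tcross (tcross r s) (tcross p t)) j)
        (tcross r (tcross (tcross p s) (tcross q t)) j) := by
  fin_cases j <;>
  simp only [tcross, Fin.reduceFinMk, Fin.zero_eta, Fin.mk_one, Matrix.cons_val, max_add, add_max,
    max_le_iff] <;>
  simp only [le_max_iff] <;>
  simp only [add_comm, add_left_comm, add_assoc, le_refl, true_or, or_true, and_self]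

set_option maxHeartbeats 1000000 in
-- The proof splits into 27 cases.
/-- The coordinate inequality behind `onTropLine_inf_tcross`; the coordinates `z i` are those of the
componentwise minimum of the three pairwise stable intersections. -/
theorem add_le_max_of_eq_min {ι : Type*} {a b c z : ι → ℝ} (ha : ∀ j, a j ≤ max (b j) (c j))
    (hb : ∀ j, b j ≤ max (c j) (a j)) (hc : ∀ j, c j ≤ max (a j) (b j)) {i j k : ι}
    (hi : z i = min (max (a j + b k) (a k + b j))
      (min (max (b j + c k) (b k + c j)) (max (c j + a k) (c k + a j))))
    (hj : z j = min (max (a i + b k) (a k + b i))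
      (min (max (b i + c k) (b k + c i)) (max (c i + a k) (c k + a i))))
    (hk : z k = min (max (a i + b j) (a j + b i))
      (min (max (b i + c j) (b j + c i)) (max (c i + a j) (c j + a i)))) :
    a i + z i ≤ max (a j + z j) (a k + z k) := by
  have low m := eq_and_le_cases_of_le_max (ha m) (hb m) (hc m)
  have li := low i
  have lj := low j
  have lk := low k
  rw [hi, hj, hk]
  clear ha hb hc low hi hj hk
  generalize a i = ai, a j = aj, a k = ak, b i = bi, b j = bj, b k = bk, c i = ci, c j = cj,
    c k = ck at *
  rcases li with ⟨rfl, hi⟩ | ⟨rfl, hi⟩ | ⟨rfl, hi⟩ <;>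
  rcases lj with ⟨rfl, hj⟩ | ⟨rfl, hj⟩ | ⟨rfl, hj⟩ <;>
  rcases lk with ⟨rfl, hk⟩ | ⟨rfl, hk⟩ | ⟨rfl, hk⟩ <;>
  · simp only [le_max_iff, min_le_iff, add_max, add_min, max_le_iff, le_min_iff]
    grind

theorem onTropLine_inf_tcross {a b c : Fin 3 → ℝ}
    (ha : ∀ j, a j ≤ max (b j) (c j)) (hb : ∀ j, b j ≤ max (c j) (a j))
    (hc : ∀ j, c j ≤ max (a j) (b j)) :
    OnTropLine a (tcross a b ⊓ (tcross b c ⊓ tcross c a)) := by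
  have swap (x x' y y' u u' : ℝ) :
      min (max x x') (min (max y y') (max u u')) = min (max x' x) (min (max y' y) (max u' u)) := by
    rw [max_comm x, max_comm y, max_comm u]
  apply onTropLine_of_le_max
  · exact add_le_max_of_eq_min ha hb hc rfl rfl rfl
  · exact add_le_max_of_eq_min ha hb hc rfl rfl (swap ..)
  · exact add_le_max_of_eq_min ha hb hc rfl (swap ..) (swap ..)

theorem exists_onTropLine_of_le_max {a b c : Fin 3 → ℝ}
    (ha : ∀ j, a j ≤ max (b j) (c j)) (hb : ∀ j, b j ≤ max (c j) (a j))
    (hc : ∀ j, c j ≤ max (a j) (b j)) :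
    ∃ z, OnTropLine a z ∧ OnTropLine b z ∧ OnTropLine c z := by
  refine ⟨tcross a b ⊓ (tcross b c ⊓ tcross c a), onTropLine_inf_tcross ha hb hc, ?_, ?_⟩
  · rw [inf_comm, inf_assoc]
    exact onTropLine_inf_tcross hb hc ha
  · rw [← inf_assoc, inf_comm]
    exact onTropLine_inf_tcross hc ha hb

theorem constructive_tropical_pappus (p1 p2 p3 p4 p5 : Fin 3 → ℝ) :
    ∃ z : Fin 3 → ℝ,
      OnTropLine (tcross p1 (tcross (tcross p2 p4) (tcross p3 p5))) z ∧
      OnTropLine (tcross p2 (tcross (tcross p3 p4) (tcross p1 p5))) z ∧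
      OnTropLine (tcross p3 (tcross (tcross p1 p4) (tcross p2 p5))) z :=
  exists_onTropLine_of_le_max (tcross_pappus_le_max p1 p2 p3 p4 p5)
    (tcross_pappus_le_max p2 p3 p1 p4 p5) (tcross_pappus_le_max p3 p1 p2 p4 p5)
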